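/- There exists a function H : ℂ → ℂ analytic on U = { s ∈ ℂ : s ≠ 1, s ≠ 0, and s ≠ 1 − 2m for every integer m ≥ 1 }, with H(s) = Σ_{n=1}^∞ H_n n^{−s} for all Re(s) > 1, such that for every integer m ≥ 1, H(−2m) − ζ(1 − 2m) = (2m)!·A_{2m+1}, where ζ is the Riemann zeta function and A_n = Σ_{k=1}^{n} (B(k)/(k!·k))·(B(n−k)/(n−k)!) with B(j) the Bernoulli numbers with B(1) = +1/2. -/

import Mathlib

open Complex Finset

/-- The domain of analyticity of the continuation of the Euler sum `h(s) = Σ H_n n^{−s}`: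
all `s` except `s = 1`, `s = 0` and the negative odd integers `s = 1 − 2m`, `m ≥ 1`. -/
def eulerSumDomain : Set ℂ :=
  {s : ℂ | s ≠ 1 ∧ s ≠ 0 ∧ ∀ m : ℕ, 1 ≤ m → s ≠ 1 - 2 * (m : ℂ)}

/-- The convolution `A_n = Σ_{k+j=n, k≥1, j≥0} (B(k)/(k!·k))·(B(j)/j!)` where `B` are the
Bernoulli numbers with the convention `B(1) = +1/2` (Mathlib's `bernoulli'`). -/
noncomputable def convA (n : ℕ) : ℂ :=
  ∑ k ∈ Finset.Icc 1 n,
    ((bernoulli' k : ℚ) : ℂ) / ((Nat.factorial k : ℂ) * k) *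
      (((bernoulli' (n - k) : ℚ) : ℂ) / (Nat.factorial (n - k) : ℂ))

namespace EulerAux
open Filter Topology Asymptotics Set MeasureTheory

/-- the rising product -/
noncomputable def P (j : ℕ) (s : ℂ) : ℂ := ∏ i ∈ Finset.range j, (s + i)

lemma inv_Gamma_eq (j : ℕ) (s : ℂ) :
    (Complex.Gamma s)⁻¹ = P j s * (Complex.Gamma (s + j))⁻¹ := by
  induction j with
  | zero => simp [P]
  | succ n ih =>
    rw [ih, one_div_Gamma_eq_self_mul_one_div_Gamma_add_one (s + n)]
    simp only [P, Finset.prod_range_succ]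
    push_cast
    rw [← add_assoc s]
    ring

lemma P_neg (N : ℕ) : P N (-(N : ℂ)) = (-1) ^ N * (N.factorial : ℂ) := by
  unfold P
  have : ∀ i ∈ Finset.range N, (-(N : ℂ) + i) = (-1) * ((N - 1 - i : ℕ) + 1 : ℕ) := by
    intro i hi
    have hi := Finset.mem_range.1 hi
    have : N - 1 - i + 1 = N - i := by omega
    rw [this, Nat.cast_sub hi.le]; ring
  rw [Finset.prod_congr rfl this, Finset.prod_mul_distrib, Finset.prod_const, Finset.card_range,
    Finset.prod_range_reflect (fun k => ((k + 1 : ℕ) : ℂ)) N, ← Finset.prod_range_add_one_eq_factorial]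
  push_cast; rfl

lemma P_neg_lt {j N : ℕ} (h : N < j) : P j (-(N : ℂ)) = 0 :=
  Finset.prod_eq_zero (Finset.mem_range.2 h) (by simp)

lemma differentiable_P (j : ℕ) : Differentiable ℂ (P j) := by
  unfold P; fun_prop

/-- remainder -/
noncomputable def rem (f : ℝ → ℂ) (c : ℕ → ℂ) : ℕ → ℝ → ℂ
  | 0 => f
  | K + 1 => fun t => rem f c K t - c K • (Ioc (0 : ℝ) 1).indicator (fun t : ℝ => (t : ℂ) ^ (K : ℂ)) t

lemma rem_eq (f : ℝ → ℂ) (c : ℕ → ℂ) (K : ℕ) {t : ℝ} (ht : t ∈ Ioc (0:ℝ) 1) :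
    rem f c K t = f t - ∑ j ∈ Finset.range K, c j * (t : ℂ) ^ j := by
  induction K with
  | zero => simp [rem]
  | succ n ih =>
    simp only [rem]
    rw [ih, Finset.sum_range_succ, indicator_of_mem ht]
    simp only [cpow_natCast, smul_eq_mul]; ring

lemma rem_eq' (f : ℝ → ℂ) (c : ℕ → ℂ) (K : ℕ) {t : ℝ} (ht : 1 < t) :
    rem f c K t = f t := by
  induction K with
  | zero => simp [rem]
  | succ n ih =>
    simp only [rem]
    rw [ih, indicator_of_notMem (by simp [ht])]
    simp

lemma rem_loc {f : ℝ → ℂ} (c : ℕ → ℂ) (hf : LocallyIntegrableOn f (Ioi 0)) (K : ℕ) :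
    LocallyIntegrableOn (rem f c K) (Ioi 0) := by
  induction K with
  | zero => exact hf
  | succ n ih =>
    refine ih.sub ?_
    have h1 : Continuous (fun t : ℝ => (t : ℂ) ^ n) := by fun_prop
    have h2 := (h1.locallyIntegrable (μ := volume)).indicator (measurableSet_Ioc (a := (0:ℝ)) (b := 1))
    have h3 := (h2.smul (c n)).locallyIntegrableOn (Ioi 0)
    simp only [cpow_natCast]
    exact h3

/-- pieces of the continuation -/
noncomputable def RK (f : ℝ → ℂ) (c : ℕ → ℂ) (K : ℕ) (s : ℂ) : ℂ :=
  mellin (rem f c K) s * (Complex.Gamma s)⁻¹ +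
    ∑ j ∈ Finset.range K, c j * (P j s * (Complex.Gamma (s + j + 1))⁻¹)

theorem mellin_reg {f : ℝ → ℂ} {F : ℂ → ℂ} (hF : AnalyticAt ℂ F 0)
    (hfF : ∀ᶠ t : ℝ in 𝓝[>] 0, f t = F t) (hloc : LocallyIntegrableOn f (Ioi 0))
    (hdec : ∀ a : ℝ, f =O[atTop] (fun t : ℝ => t ^ (-a))) :
    ∃ R : ℂ → ℂ, Differentiable ℂ R ∧ (∀ s : ℂ, 0 < s.re → R s = mellin f s * (Complex.Gamma s)⁻¹) ∧
      ∀ N : ℕ, R (-(N : ℂ)) = (-1) ^ N * iteratedDeriv N F 0 := by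
  set c : ℕ → ℂ := fun j => iteratedDeriv j F 0 / (j.factorial : ℂ) with hc
  have hbot : ∀ K : ℕ, rem f c K =O[𝓝[>] 0] (fun t : ℝ => t ^ (-(-(K : ℝ)))) := by
    intro K
    have h1 := hF.hasFPowerSeriesAt.isBigO_sub_partialSum_pow K
    have h2 : Tendsto (fun t : ℝ => (t : ℂ)) (𝓝[>] 0) (𝓝 0) := by
      have : Tendsto (fun t : ℝ => (t : ℂ)) (𝓝 0) (𝓝 ((0 : ℝ) : ℂ)) := continuous_ofReal.tendsto 0
      simpa using this.mono_left nhdsWithin_le_nhds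
    have h3 := h1.comp_tendsto h2
    refine IsBigO.congr' h3 ?_ ?_
    · filter_upwards [hfF, Ioc_mem_nhdsGT (zero_lt_one' ℝ)] with t ht ht'
      rw [rem_eq f c K ht', ht]
      simp [FormalMultilinearSeries.partialSum, hc, FormalMultilinearSeries.ofScalars, mul_comm]
    · filter_upwards [Ioc_mem_nhdsGT (zero_lt_one' ℝ)] with t ht'
      simp [abs_of_pos ht'.1]
  have htop : ∀ K : ℕ, ∀ a : ℝ, rem f c K =O[atTop] (fun t : ℝ => t ^ (-a)) := by
    intro K a
    refine (hdec a).congr' ?_ EventuallyEq.rfl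
    filter_upwards [eventually_gt_atTop 1] with t ht
    rw [rem_eq' f c K ht]
  have hloc' := rem_loc c hloc
  have hconv : ∀ (K : ℕ) (s : ℂ), -(K : ℝ) < s.re → MellinConvergent (rem f c K) s := fun K s hs =>
    mellinConvergent_of_isBigO_rpow (hloc' K) (htop K (s.re + 1)) (by linarith) (hbot K) hs
  have hdiff : ∀ (K : ℕ) (s : ℂ), -(K : ℝ) < s.re → DifferentiableAt ℂ (RK f c K) s := by
    intro K s hs
    have h1 : DifferentiableAt ℂ (mellin (rem f c K)) s :=
      mellin_differentiableAt_of_isBigO_rpow (hloc' K) (htop K (s.re + 1)) (by linarith) (hbot K) hs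
    refine (h1.mul (differentiable_one_div_Gamma s)).add (DifferentiableAt.fun_sum fun j _ => ?_)
    refine ((differentiable_P j s).mul ?_).const_mul _
    exact DifferentiableAt.comp (g := fun s => (Complex.Gamma s)⁻¹) s
      (differentiable_one_div_Gamma (s + j + 1)) (f := fun s : ℂ => s + (j : ℂ) + 1) (by fun_prop)
  have hsucc : ∀ (K : ℕ) (s : ℂ), -(K : ℝ) < s.re → RK f c (K + 1) s = RK f c K s := by
    intro K s hs
    have h1 := hasMellin_cpow_Ioc (K : ℂ) (s := s) (by simpa using by linarith)
    have h2 := hasMellin_sub (hconv K s hs) (h1.1.const_smul (c K))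
    have h3 : mellin (rem f c (K + 1)) s = mellin (rem f c K) s - c K * (1 / (s + K)) := by
      have := h2.2
      rw [mellin_const_smul, h1.2] at this
      exact this
    have h0 : s + K ≠ 0 := by
      intro h
      have := congrArg Complex.re h
      simp at this; linarith
    have h4 : (Complex.Gamma s)⁻¹ = P K s * ((s + K) * (Complex.Gamma (s + K + 1))⁻¹) := by
      rw [inv_Gamma_eq K, ← one_div_Gamma_eq_self_mul_one_div_Gamma_add_one]
    have h5 : 1 / (s + K) * (Complex.Gamma s)⁻¹ = P K s * (Complex.Gamma (s + K + 1))⁻¹ := by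
      rw [h4]; field_simp
    unfold RK
    rw [h3, Finset.sum_range_succ, ← h5]
    ring
  have hle : ∀ (K L : ℕ) (s : ℂ), K ≤ L → -(K : ℝ) < s.re → RK f c L s = RK f c K s := by
    intro K L s hKL hs
    induction L, hKL using Nat.le_induction with
    | base => rfl
    | succ n hn ih =>
      rw [hsucc n s, ih]
      have : (K : ℝ) ≤ n := by exact_mod_cast hn
      linarith
  have hk : ∀ s : ℂ, -((⌊-s.re⌋₊ + 1 : ℕ) : ℝ) < s.re := by
    intro s
    have := Nat.lt_floor_add_one (-s.re)
    push_cast; linarith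
  have huniq : ∀ (K : ℕ) (s : ℂ), -(K : ℝ) < s.re → RK f c (⌊-s.re⌋₊ + 1) s = RK f c K s := by
    intro K s hs
    rcases le_total K (⌊-s.re⌋₊ + 1) with h | h
    · exact hle _ _ _ h hs
    · exact (hle _ _ _ h (hk s)).symm
  refine ⟨fun s => RK f c (⌊-s.re⌋₊ + 1) s, ?_, ?_, ?_⟩
  · intro s
    refine (hdiff _ s (hk s)).congr_of_eventuallyEq ?_
    have : ∀ᶠ z : ℂ in 𝓝 s, -((⌊-s.re⌋₊ + 1 : ℕ) : ℝ) < z.re :=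
      (isOpen_lt continuous_const continuous_re).mem_nhds (hk s)
    filter_upwards [this] with z hz
    exact huniq _ z hz
  · intro s hs
    show RK f c (⌊-s.re⌋₊ + 1) s = _
    rw [huniq 0 s (by simpa using hs)]
    simp [RK, rem]
  · intro N
    show RK f c (⌊-(-(N : ℂ)).re⌋₊ + 1) (-(N : ℂ)) = _
    rw [huniq (N + 1) _ (by simp)]
    unfold RK
    rw [Complex.Gamma_neg_nat_eq_zero, inv_zero, mul_zero, zero_add, Finset.sum_eq_single N]
    · rw [P_neg]
      have : (N.factorial : ℂ) ≠ 0 := by exact_mod_cast N.factorial_ne_zero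
      simp [hc]
      field_simp
    · intro j hj hjN
      have : j < N := by have := Finset.mem_range.1 hj; omega
      have h2 : -(N : ℂ) + j + 1 = -((N - j - 1 : ℕ) : ℂ) := by
        rw [Nat.cast_sub (by omega), Nat.cast_sub (by omega)]; push_cast; ring
      rw [h2, Complex.Gamma_neg_nat_eq_zero]; simp
    · intro h; simp at h

end EulerAux

namespace EulerAux
open Filter Topology Asymptotics Set MeasureTheory

/-- `1/(e^t-1)` -/
noncomputable def phi (t : ℝ) : ℂ := (((Real.exp t - 1)⁻¹ : ℝ) : ℂ)

lemma exp_sub_pos {t : ℝ} (ht : 0 < t) : 0 < Real.exp t - 1 := by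
  have := Real.add_one_lt_exp ht.ne'
  linarith

lemma phi_cont : ContinuousOn phi (Ioi 0) := by
  unfold phi
  refine continuous_ofReal.comp_continuousOn (ContinuousOn.inv₀ (by fun_prop) ?_)
  intro t ht
  exact (exp_sub_pos ht).ne'

lemma phi_loc : LocallyIntegrableOn phi (Ioi 0) :=
  phi_cont.locallyIntegrableOn measurableSet_Ioi

lemma norm_phi {t : ℝ} (ht : 0 < t) : ‖phi t‖ = (Real.exp t - 1)⁻¹ := by
  rw [phi, norm_real, Real.norm_of_nonneg (inv_nonneg.2 (exp_sub_pos ht).le)]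

lemma phi_top_exp : phi =O[atTop] (fun t : ℝ => Real.exp (-1 * t)) := by
  refine IsBigO.of_bound 2 ?_
  filter_upwards [eventually_ge_atTop 1] with t ht
  rw [norm_phi (by linarith), Real.norm_of_nonneg (Real.exp_pos _).le]
  have h1 := Real.add_one_le_exp t
  have h2 : Real.exp (-1 * t) = (Real.exp t)⁻¹ := by rw [← Real.exp_neg]; ring_nf
  rw [h2, ← div_eq_mul_inv, inv_eq_one_div, div_le_div_iff₀ (by linarith) (by linarith)]
  linarith

lemma phi_top (a : ℝ) : phi =O[atTop] (fun t : ℝ => t ^ (-a)) :=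
  phi_top_exp.trans (isLittleO_exp_neg_mul_rpow_atTop one_pos _).isBigO

lemma tphi_top {h : ℝ → ℂ} (hh : h =O[atTop] (fun t : ℝ => t)) (a : ℝ) :
    (fun t => h t * phi t) =O[atTop] (fun t : ℝ => t ^ (-a)) := by
  refine (hh.mul (phi_top (a + 1))).congr' EventuallyEq.rfl ?_
  filter_upwards [eventually_gt_atTop 0] with t ht
  nth_rewrite 1 [← Real.rpow_one t]
  rw [← Real.rpow_add ht]
  ring_nf

lemma phi_bot : phi =O[𝓝[>] 0] (fun t : ℝ => t ^ (-(1:ℝ))) := by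
  refine IsBigO.of_bound 1 ?_
  filter_upwards [self_mem_nhdsWithin] with t (ht : 0 < t)
  rw [norm_phi ht, Real.rpow_neg_one, one_mul, Real.norm_of_nonneg (inv_nonneg.2 ht.le)]
  have h1 := Real.add_one_le_exp t
  exact inv_anti₀ ht (by linarith)

lemma hasSum_phi {t : ℝ} (ht : 0 < t) :
    HasSum (fun n : ℕ => (1 : ℂ) * Real.exp (-((n : ℝ) + 1) * t)) (phi t) := by
  have h1 : Real.exp (-t) < 1 := by simpa using ht
  have h := (hasSum_geometric_of_lt_one (Real.exp_pos (-t)).le h1).mul_left (Real.exp (-t))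
  have h2 : Real.exp (-t) * (1 - Real.exp (-t))⁻¹ = (Real.exp t - 1)⁻¹ := by
    have := exp_sub_pos ht
    have h3 : 1 - Real.exp (-t) ≠ 0 := by linarith
    rw [Real.exp_neg] at h3 ⊢
    have := Real.exp_pos t
    field_simp
  rw [h2] at h
  have h4 : HasSum _ (phi t) := Complex.hasSum_ofReal.2 h
  convert h4 using 2 with n
  rw [one_mul, ← Real.exp_nat_mul, ← Real.exp_add]
  congr 2
  ring

lemma mellin_phi {s : ℂ} (hs : 1 < s.re) : mellin phi s = Complex.Gamma s * riemannZeta s := by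
  have h := hasSum_mellin (a := fun _ : ℕ => (1 : ℂ)) (p := fun n : ℕ => (n : ℝ) + 1) (F := phi) (s := s)
    (fun i => Or.inr (by positivity)) (by linarith) (fun t ht => hasSum_phi ht) (by
      have := (summable_nat_add_iff 1).2 (Real.summable_one_div_nat_rpow.2 hs)
      simpa using this)
  rw [← h.tsum_eq, zeta_eq_tsum_one_div_nat_add_one_cpow hs, ← tsum_mul_left]
  refine tsum_congr fun n => ?_
  push_cast
  ring

end EulerAux

namespace EulerAux
open Filter Topology Asymptotics Set MeasureTheory

/-- `(e^z-1)/z` -/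
noncomputable def p : ℂ → ℂ := dslope (fun z => Complex.exp z - 1) 0

lemma analyticAt_dslope {f : ℂ → ℂ} {z : ℂ} (hf : AnalyticAt ℂ f z) : AnalyticAt ℂ (dslope f z) z := by
  obtain ⟨q, hq⟩ := hf
  exact ⟨_, hq.has_fpower_series_dslope_fslope⟩

lemma p_an0 : AnalyticAt ℂ p 0 := analyticAt_dslope (by fun_prop)

lemma p_of_ne {z : ℂ} (hz : z ≠ 0) : p z = (Complex.exp z - 1) / z := by
  rw [p, dslope_of_ne _ hz, slope_def_field]; simp

lemma p_zero : p 0 = 1 := by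
  rw [p, dslope_same]
  simp

lemma mul_p (z : ℂ) : z * p z = Complex.exp z - 1 := by
  rcases eq_or_ne z 0 with rfl | hz
  · simp
  · rw [p_of_ne hz]; field_simp

lemma p_neg (z : ℂ) : p z = Complex.exp z * p (-z) := by
  rcases eq_or_ne z 0 with rfl | hz
  · simp
  · rw [p_of_ne hz, p_of_ne (neg_ne_zero.2 hz), Complex.exp_neg]
    have := Complex.exp_ne_zero z
    field_simp
    ring

/-- the even function -/
noncomputable def Eh (z : ℂ) : ℂ := z / 2 + Complex.log (p (-z))
/-- `Eh z/(e^z-1)` -/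
noncomputable def Fh (z : ℂ) : ℂ := dslope Eh 0 z / p z
/-- `z/(e^z-1)` -/
noncomputable def Gh (z : ℂ) : ℂ := (p z)⁻¹

lemma pneg_an0 : AnalyticAt ℂ (fun z => p (-z)) 0 :=
  AnalyticAt.fun_comp (g := p) (f := fun z => -z) (by simpa using p_an0) (by fun_prop)

lemma Eh_zero : Eh 0 = 0 := by simp [Eh, p_zero]

lemma Eh_an : AnalyticAt ℂ Eh 0 := by
  unfold Eh
  refine AnalyticAt.add (by fun_prop) (pneg_an0.clog ?_)
  simp [p_zero]

lemma Gh_an : AnalyticAt ℂ Gh 0 := p_an0.inv (by simp [p_zero])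

lemma Fh_an : AnalyticAt ℂ Fh 0 := (analyticAt_dslope Eh_an).div p_an0 (by simp [p_zero])

lemma Fh_of_ne {z : ℂ} (hz : z ≠ 0) : Fh z = Eh z / (Complex.exp z - 1) := by
  rw [Fh, dslope_of_ne _ hz, slope_def_field, ← mul_p, Eh_zero]
  simp
  rw [div_div]

lemma Eh_even : ∀ᶠ z in 𝓝 (0 : ℂ), Eh (-z) = Eh z := by
  have h1 : ContinuousAt (fun z : ℂ => (Complex.exp z).arg + (p (-z)).arg) 0 := by
    refine ContinuousAt.add ?_ ?_
    · exact ContinuousAt.comp' (g := Complex.arg) (continuousAt_arg (by simp)) (by fun_prop)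
    · exact ContinuousAt.comp' (g := Complex.arg) (f := fun z => p (-z)) (continuousAt_arg (by simp [p_zero]))
        pneg_an0.continuousAt
  have h2 : ∀ᶠ z : ℂ in 𝓝 0, (Complex.exp z).arg + (p (-z)).arg ∈ Ioo (-Real.pi) Real.pi :=
    h1.eventually_mem (Ioo_mem_nhds (by simp [p_zero, Real.pi_pos]) (by simp [p_zero, Real.pi_pos]))
  have h3 : ∀ᶠ z : ℂ in 𝓝 0, z.im ∈ Ioo (-Real.pi) Real.pi :=
    continuous_im.continuousAt.eventually_mem (Ioo_mem_nhds (by simp [Real.pi_pos]) (by simp [Real.pi_pos]))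
  have h4 : ∀ᶠ z : ℂ in 𝓝 0, p (-z) ≠ 0 := pneg_an0.continuousAt.eventually_ne (by simp [p_zero])
  filter_upwards [h2, h3, h4] with z h2 h3 h4
  rw [Eh, Eh, neg_neg, p_neg z, (Complex.log_mul_eq_add_log_iff (Complex.exp_ne_zero z) h4).2 ⟨h2.1, h2.2.le⟩,
    Complex.log_exp h3.1 h3.2.le]
  ring

lemma exp_sub_ne : ∀ᶠ z in 𝓝[≠] (0 : ℂ), Complex.exp z - 1 ≠ 0 := by
  have h4 : ∀ᶠ z : ℂ in 𝓝 0, p z ≠ 0 := p_an0.continuousAt.eventually_ne (by simp [p_zero])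
  filter_upwards [h4.filter_mono nhdsWithin_le_nhds, self_mem_nhdsWithin] with z h hz
  rw [← mul_p]
  exact mul_ne_zero hz h

lemma Fneg_an : AnalyticAt ℂ (fun z => Fh (-z)) 0 :=
  AnalyticAt.fun_comp (g := Fh) (f := fun z => -z) (by simpa using Fh_an) (by fun_prop)

lemma F_sym : ∀ᶠ z in 𝓝 (0 : ℂ), Fh z + Fh (-z) = - Eh z := by
  rw [← AnalyticAt.frequently_eq_iff_eventually_eq (Fh_an.fun_add Fneg_an) Eh_an.fun_neg]
  refine Eventually.frequently ?_
  filter_upwards [Eh_even.filter_mono nhdsWithin_le_nhds, self_mem_nhdsWithin, exp_sub_ne] with z h1 hz h2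
  rw [Fh_of_ne hz, Fh_of_ne (neg_ne_zero.2 hz), h1]
  have h5 : Complex.exp (-z) - 1 = - (Complex.exp z - 1) * (Complex.exp z)⁻¹ := by
    rw [Complex.exp_neg]
    have := Complex.exp_ne_zero z
    field_simp
    ring
  rw [h5]
  have := Complex.exp_ne_zero z
  field_simp
  ring

lemma E_deriv : ∀ᶠ z in 𝓝 (0 : ℂ), z * deriv Eh z = Gh z + (z / 2 - 1) := by
  have h1 := pneg_an0.eventually_analyticAt
  have h2 : ∀ᶠ z : ℂ in 𝓝 0, p (-z) ∈ slitPlane :=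
    pneg_an0.continuousAt.eventually_mem (isOpen_slitPlane.mem_nhds (by simp [p_zero]))
  filter_upwards [h1, h2] with z h1 h2
  have hd := h1.differentiableAt.hasDerivAt
  set d := deriv (fun z => p (-z)) z
  have h3 : HasDerivAt (fun z => -z * p (-z)) (-1 * p (-z) + -z * d) z :=
    (hasDerivAt_neg z).mul hd
  have h4 : HasDerivAt (fun z => -z * p (-z)) (Complex.exp (-z) * (-1)) z := by
    simp only [mul_p]
    exact ((hasDerivAt_neg z).cexp).sub_const 1
  have h5 := h3.unique h4
  have h6 : HasDerivAt Eh (1 / 2 + d / p (-z)) z :=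
    ((hasDerivAt_id z).div_const 2).add (hd.clog h2)
  have h7 : p (-z) ≠ 0 := slitPlane_ne_zero h2
  rw [h6.deriv, Gh, p_neg z]
  rw [Complex.exp_neg] at h5
  have h8 := Complex.exp_ne_zero z
  have h9 : z * d = (Complex.exp z)⁻¹ - p (-z) := by linear_combination -h5
  have h10 : z * (1 / 2 + d / p (-z)) = z / 2 + z * d / p (-z) := by ring
  rw [h10, h9]
  field_simp
  ring

lemma iter_Eh {N : ℕ} (hN : 2 ≤ N) : (N : ℂ) * iteratedDeriv N Eh 0 = iteratedDeriv N Gh 0 := by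
  have h1 : iteratedDeriv N (fun z => z * deriv Eh z) 0 = iteratedDeriv N (fun z => Gh z + (z / 2 - 1)) 0 :=
    Filter.EventuallyEq.iteratedDeriv_eq N E_deriv
  have hp : AnalyticAt ℂ (fun z : ℂ => z / 2 - 1) 0 := by fun_prop
  rw [iteratedDeriv_fun_add Gh_an.contDiffAt hp.contDiffAt,
    iteratedDeriv_fun_mul contDiffAt_fun_id Eh_an.deriv.contDiffAt] at h1
  have h2 : iteratedDeriv N (fun z : ℂ => z / 2 - 1) 0 = 0 := by
    obtain ⟨k, rfl⟩ : ∃ k, N = k + 2 := ⟨N - 2, by omega⟩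
    rw [iteratedDeriv_succ', iteratedDeriv_succ']
    have : deriv (fun z : ℂ => z / 2 - 1) = fun _ => 1 / 2 := by
      ext z; simp
    rw [this]
    simp
  rw [h2, add_zero, Finset.sum_eq_single 1] at h1
  · rw [← h1, ← iteratedDeriv_succ', Nat.sub_add_cancel (by omega)]
    simp [iteratedDeriv_fun_id_zero]
  · intro b _ hb
    rw [iteratedDeriv_fun_id_zero]; simp [hb]
  · intro h; simp at h; omega

lemma iter_Fh {m : ℕ} (hm : 1 ≤ m) : 4 * (m : ℂ) * iteratedDeriv (2 * m) Fh 0 = - iteratedDeriv (2 * m) Gh 0 := by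
  have h1 : iteratedDeriv (2 * m) (fun z => Fh z + Fh (-z)) 0 = iteratedDeriv (2 * m) (fun z => - Eh z) 0 :=
    Filter.EventuallyEq.iteratedDeriv_eq _ F_sym
  rw [iteratedDeriv_fun_add Fh_an.contDiffAt Fneg_an.contDiffAt, iteratedDeriv_comp_neg, iteratedDeriv_fun_neg] at h1
  have h2 := iter_Eh (N := 2 * m) (by omega)
  simp at h1
  push_cast at h2
  rw [← h2]
  linear_combination 2 * (m : ℂ) * h1

end EulerAux

namespace EulerAux
open Filter Topology Asymptotics Set MeasureTheory

/-- `-log(1-e^{-t})` -/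
noncomputable def Lf (t : ℝ) : ℝ := -Real.log (1 - Real.exp (-t))

/-- real form of `Eh` -/
noncomputable def Er (t : ℝ) : ℝ := t / 2 + (Real.log (1 - Real.exp (-t)) - Real.log t)

lemma one_sub_pos {t : ℝ} (ht : 0 < t) : 0 < 1 - Real.exp (-t) := by
  have : Real.exp (-t) < 1 := by simpa using ht
  linarith

lemma Lf_eq (t : ℝ) : Lf t = - Real.log t + t / 2 - Er t := by
  unfold Lf Er; ring

lemma Eh_ofReal {t : ℝ} (ht : 0 < t) : Eh t = (Er t : ℂ) := by
  have h0 : (t : ℂ) ≠ 0 := by exact_mod_cast ht.ne'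
  have h1 : p (-(t : ℂ)) = (((1 - Real.exp (-t)) / t : ℝ) : ℂ) := by
    rw [p_of_ne (neg_ne_zero.2 h0)]
    push_cast
    field_simp
    ring
  rw [Eh, h1, ← Complex.ofReal_log (div_pos (one_sub_pos ht) ht).le,
    Real.log_div (one_sub_pos ht).ne' ht.ne', Er]
  push_cast
  rfl

/-- the smooth function -/
noncomputable def ff (t : ℝ) : ℂ := (Er t : ℂ) * phi t
/-- `t/(e^t-1)` -/
noncomputable def gg (t : ℝ) : ℂ := (t : ℂ) * phi t

lemma ff_eq {t : ℝ} (ht : 0 < t) : ff t = Fh t := by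
  have h0 : (t : ℂ) ≠ 0 := by exact_mod_cast ht.ne'
  rw [ff, Fh_of_ne h0, Eh_ofReal ht, phi, div_eq_mul_inv]
  push_cast; rfl

lemma gg_eq {t : ℝ} (ht : 0 < t) : gg t = Gh t := by
  have h0 : (t : ℂ) ≠ 0 := by exact_mod_cast ht.ne'
  rw [gg, Gh, p_of_ne h0, phi, inv_div, div_eq_mul_inv]
  push_cast; rfl

lemma Er_top : (fun t : ℝ => (Er t : ℂ)) =O[atTop] (fun t : ℝ => t) := by
  refine IsBigO.of_bound 3 ?_
  filter_upwards [eventually_ge_atTop 1] with t ht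
  have h0 : 0 < t := by linarith
  rw [norm_real, Real.norm_eq_abs, Real.norm_eq_abs, abs_of_pos h0, abs_le]
  have h1 := one_sub_pos h0
  have h2 := Real.one_sub_inv_le_log_of_pos h1
  have h3 := Real.log_le_sub_one_of_pos h1
  have h4 := Real.log_nonneg ht
  have h5 := Real.log_le_sub_one_of_pos h0
  have h6 := Real.exp_pos (-t)
  have h7 : (1 - Real.exp (-t))⁻¹ ≤ 2 := by
    rw [inv_le_comm₀ h1 (by norm_num)]
    have : Real.exp (-t) ≤ 1 / 2 := by
      rw [Real.exp_neg, inv_eq_one_div]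
      apply one_div_le_one_div_of_le (by norm_num)
      linarith [Real.add_one_le_exp t]
    linarith
  unfold Er
  constructor <;> linarith

lemma ff_loc : LocallyIntegrableOn ff (Ioi 0) := by
  refine ContinuousOn.locallyIntegrableOn ?_ measurableSet_Ioi
  refine ContinuousOn.mul (continuous_ofReal.comp_continuousOn ?_) phi_cont
  unfold Er
  refine ContinuousOn.add (by fun_prop) (ContinuousOn.sub ?_ ?_)
  · exact ContinuousOn.log (by fun_prop) fun t ht => (one_sub_pos ht).ne'
  · exact ContinuousOn.log (by fun_prop) fun t ht => (ne_of_gt ht)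

lemma gg_loc : LocallyIntegrableOn gg (Ioi 0) :=
  ContinuousOn.locallyIntegrableOn (ContinuousOn.mul (by fun_prop) phi_cont) measurableSet_Ioi

lemma gg_top (a : ℝ) : gg =O[atTop] (fun t : ℝ => t ^ (-a)) :=
  tphi_top (h := fun t => (t : ℂ)) (IsBigO.of_bound 1 (by simp)) a

lemma ff_top (a : ℝ) : ff =O[atTop] (fun t : ℝ => t ^ (-a)) := tphi_top Er_top a

lemma mellin_gg {s : ℂ} (hs : 0 < s.re) : mellin gg s = s * Complex.Gamma s * riemannZeta (s + 1) := by
  have h := mellin_cpow_smul phi s 1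
  simp only [cpow_one, smul_eq_mul] at h
  have h0 : s ≠ 0 := by rintro rfl; simp at hs
  rw [← Complex.Gamma_add_one s h0, ← mellin_phi (s := s + 1) (by simpa using hs), ← h]
  rfl

lemma zeta_an {s : ℂ} (hs : s ≠ 1) : AnalyticAt ℂ riemannZeta s := by
  have h : DifferentiableOn ℂ riemannZeta {1}ᶜ :=
    fun z hz => (differentiableAt_riemannZeta hz).differentiableWithinAt
  exact h.analyticAt (isOpen_compl_singleton.mem_nhds hs)

lemma zeta_add_an {s : ℂ} (hs : s ≠ 0) : AnalyticAt ℂ (fun s => riemannZeta (s + 1)) s :=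
  AnalyticAt.fun_comp (g := riemannZeta) (f := fun s => s + 1) (zeta_an (by simpa using hs)) (by fun_prop)

lemma iter_Gh {N : ℕ} (hN : 1 ≤ N) : (-1) ^ N * iteratedDeriv N Gh 0 = -(N : ℂ) * riemannZeta (-(N : ℂ) + 1) := by
  obtain ⟨R, hR1, hR2, hR3⟩ := mellin_reg Gh_an
    (by filter_upwards [self_mem_nhdsWithin] with t ht using gg_eq ht) gg_loc gg_top
  rw [← hR3]
  have hA : AnalyticOnNhd ℂ R {0}ᶜ := fun z _ => hR1.analyticAt z
  have hB : AnalyticOnNhd ℂ (fun s => s * riemannZeta (s + 1)) {0}ᶜ := fun z hz =>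
    analyticAt_id.mul (zeta_add_an hz)
  have hC : IsPreconnected ({0}ᶜ : Set ℂ) :=
    (isConnected_compl_singleton_of_one_lt_rank (by simp) 0).isPreconnected
  have hE : R =ᶠ[𝓝 1] (fun s => s * riemannZeta (s + 1)) := by
    have : ∀ᶠ z : ℂ in 𝓝 1, 0 < z.re :=
      (isOpen_lt continuous_const continuous_re).mem_nhds (by simp)
    filter_upwards [this] with s hs
    rw [hR2 s hs, mellin_gg hs]
    have := Complex.Gamma_ne_zero_of_re_pos hs
    field_simp
  exact hA.eqOn_of_preconnected_of_eventuallyEq hB hC (by simp) hE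
    (show -(N : ℂ) ∈ ({0}ᶜ : Set ℂ) by simp; omega)

/-- the smooth part -/
lemma exists_Rf : ∃ R : ℂ → ℂ, Differentiable ℂ R ∧
    (∀ s : ℂ, 0 < s.re → R s = mellin ff s * (Complex.Gamma s)⁻¹) ∧
    ∀ m : ℕ, 1 ≤ m → R (-(2 * (m : ℂ))) = riemannZeta (1 - 2 * m) / 2 := by
  obtain ⟨R, hR1, hR2, hR3⟩ := mellin_reg Fh_an
    (by filter_upwards [self_mem_nhdsWithin] with t ht using ff_eq ht) ff_loc ff_top
  refine ⟨R, hR1, hR2, fun m hm => ?_⟩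
  have h1 := hR3 (2 * m)
  have h2 := iter_Fh hm
  have h3 := iter_Gh (N := 2 * m) (by omega)
  have h4 : -(2 * (m : ℂ)) + 1 = 1 - 2 * m := by ring
  have h5 : (-1 : ℂ) ^ (2 * m) = 1 := by simp
  push_cast at h1 h3
  rw [h5, one_mul] at h1 h3
  rw [h4] at h3
  rw [h1]
  have hm0 : (m : ℂ) ≠ 0 := by exact_mod_cast (by omega : m ≠ 0)
  have h6 : 4 * (m : ℂ) * iteratedDeriv (2 * m) Fh 0 = 4 * (m : ℂ) * (riemannZeta (1 - 2 * m) / 2) := by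
    rw [h2, h3]; ring
  exact mul_left_cancel₀ (by simpa using hm0) h6

lemma ff_conv {s : ℂ} (hs : 0 < s.re) : MellinConvergent ff s := by
  refine mellinConvergent_of_isBigO_rpow (b := 0) ff_loc (ff_top (s.re + 1)) (by linarith) ?_ hs
  have h2 : Tendsto (fun t : ℝ => (t : ℂ)) (𝓝[>] 0) (𝓝 0) := by
    have : Tendsto (fun t : ℝ => (t : ℂ)) (𝓝 0) (𝓝 ((0 : ℝ) : ℂ)) := continuous_ofReal.tendsto 0
    simpa using this.mono_left nhdsWithin_le_nhds
  have h3 : Tendsto ff (𝓝[>] 0) (𝓝 (Fh 0)) := by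
    refine (Fh_an.continuousAt.tendsto.comp h2).congr' ?_
    filter_upwards [self_mem_nhdsWithin] with t ht using (ff_eq ht).symm
  simpa using h3.isBigO_one ℝ

lemma gg_conv {s : ℂ} (hs : 0 < s.re) : MellinConvergent gg s := by
  have h : MellinConvergent phi (s + 1) :=
    mellinConvergent_of_isBigO_rpow (b := 1) phi_loc (phi_top (s.re + 2))
      (by simp) phi_bot (by simpa using hs)
  have := MellinConvergent.cpow_smul.2 h
  simpa only [cpow_one, smul_eq_mul] using! this

lemma mellin_logphi {s : ℂ} (hs : 1 < s.re) :
    HasMellin (fun t => Real.log t • phi t) s (deriv (fun s => Complex.Gamma s * riemannZeta s) s) := by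
  obtain ⟨h1, h2⟩ := mellin_hasDerivAt_of_isBigO_rpow phi_loc (phi_top (s.re + 1)) (by linarith) phi_bot hs
  refine ⟨h1, ?_⟩
  rw [← h2.deriv]
  refine Filter.EventuallyEq.deriv_eq ?_
  have : ∀ᶠ z : ℂ in 𝓝 s, 1 < z.re :=
    (isOpen_lt continuous_const continuous_re).mem_nhds hs
  filter_upwards [this] with z hz using mellin_phi hz

lemma mellin_L {s : ℂ} (hs : 1 < s.re) :
    mellin (fun t => (Lf t : ℂ) * phi t) s = - deriv (fun s => Complex.Gamma s * riemannZeta s) s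
      + s * Complex.Gamma s * riemannZeta (s + 1) / 2 - mellin ff s := by
  have hs0 : 0 < s.re := by linarith
  have h1 := mellin_logphi hs
  have h2 := hasMellin_sub ((gg_conv hs0).div_const 2) h1.1
  have h3 := hasMellin_sub h2.1 (ff_conv hs0)
  rw [h2.2, h1.2, mellin_div_const, mellin_gg hs0] at h3
  have h4 : (fun t => (Lf t : ℂ) * phi t) = (fun t => gg t / 2 - Real.log t • phi t - ff t) := by
    ext t
    rw [Lf_eq, gg, ff, Complex.real_smul]
    push_cast
    ring
  rw [h4, h3.2]
  ring

lemma hasSum_L {t : ℝ} (ht : 0 < t) :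
    HasSum (fun n : ℕ => ((harmonic n : ℚ) : ℂ) * Real.exp (-((n : ℝ) + 1) * t)) ((Lf t : ℂ) * phi t) := by
  set x := Real.exp (-t) with hx
  have hx0 : 0 < x := Real.exp_pos _
  have h1 : x < 1 := by simpa [hx] using ht
  have hax : |x| < 1 := by rwa [abs_of_pos hx0]
  have hf := Real.hasSum_pow_div_log_of_abs_lt_one hax
  have hg := hasSum_geometric_of_lt_one hx0.le h1
  have h := hasSum_sum_range_mul_of_summable_norm hf.summable.norm hg.summable.norm
  rw [hf.tsum_eq, hg.tsum_eq] at h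
  have h' := h.mul_left x
  have h2 : x * (-Real.log (1 - x) * (1 - x)⁻¹) = Lf t * (Real.exp t - 1)⁻¹ := by
    have h3 : x * (1 - x)⁻¹ = (Real.exp t - 1)⁻¹ := by
      have := exp_sub_pos ht
      have h3 : 1 - x ≠ 0 := by linarith
      rw [hx, Real.exp_neg] at h3 ⊢
      have := Real.exp_pos t
      field_simp
    rw [← h3, Lf]; ring
  rw [h2] at h'
  have h4 := Complex.hasSum_ofReal.2 h'
  rw [← hasSum_nat_add_iff' 1]
  simp only [Finset.range_one, Finset.sum_singleton, harmonic_zero, Rat.cast_zero, zero_mul, sub_zero]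
  have h5 : ((Lf t * (Real.exp t - 1)⁻¹ : ℝ) : ℂ) = (Lf t : ℂ) * phi t := by
    rw [phi]; push_cast; rfl
  rw [h5] at h4
  refine Eq.subst (motive := fun g : ℕ → ℂ => HasSum g ((Lf t : ℂ) * phi t)) ?_ h4
  funext n
  symm
  have h6 : ((harmonic (n + 1) : ℚ) : ℂ) = ((∑ i ∈ Finset.range (n + 1), ((i : ℝ) + 1)⁻¹ : ℝ) : ℂ) := by
    simp only [harmonic]; push_cast; rfl
  rw [h6, ← Complex.ofReal_mul]
  congr 1
  have h7 : ∀ i ∈ Finset.range (n + 1), x ^ (i + 1) / ((i : ℝ) + 1) * x ^ (n - i) = ((i : ℝ) + 1)⁻¹ * x ^ (n + 1) := by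
    intro i hi
    have h9 : n + 1 = (i + 1) + (n - i) := by have := Finset.mem_range.1 hi; omega
    have h10 : x ^ (n + 1) = x ^ (i + 1) * x ^ (n - i) := by rw [← pow_add, ← h9]
    rw [h10]; ring
  rw [Finset.sum_congr rfl h7, ← Finset.sum_mul]
  have h8 : Real.exp (-(((n + 1 : ℕ) : ℝ) + 1) * t) = x * x ^ (n + 1) := by
    rw [hx, ← Real.exp_nat_mul, ← Real.exp_add]
    congr 1; push_cast; ring
  rw [h8]; ring

lemma summable_harm {σ : ℝ} (hs : 1 < σ) :
    Summable fun n : ℕ => ‖((harmonic n : ℚ) : ℂ)‖ / ((n : ℝ) + 1) ^ σ := by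
  set ε := (σ - 1) / 2 with hε
  have hε0 : 0 < ε := by rw [hε]; linarith
  have h1 : Summable fun n : ℕ => (1 + 1 / ε) * (1 / ((n : ℝ) + 1) ^ (σ - ε)) := by
    have := (summable_nat_add_iff 1).2 (Real.summable_one_div_nat_rpow.2 (show 1 < σ - ε by rw [hε]; linarith))
    refine Summable.mul_left _ ?_
    simpa using this
  refine Summable.of_nonneg_of_le (fun n => by positivity) (fun n => ?_) h1
  have hn : (0 : ℝ) < (n : ℝ) + 1 := by positivity
  have hn1 : (1 : ℝ) ≤ (n : ℝ) + 1 := by simp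
  have h2 : ‖((harmonic n : ℚ) : ℂ)‖ = ((harmonic n : ℚ) : ℝ) := by
    have : (0 : ℝ) ≤ ((harmonic n : ℚ) : ℝ) := by
      have : 0 ≤ harmonic n := Finset.sum_nonneg fun i _ => by positivity
      exact_mod_cast this
    rw [← Complex.ofReal_ratCast, norm_real, Real.norm_of_nonneg this]
  have h3 : ((harmonic n : ℚ) : ℝ) ≤ (1 + 1 / ε) * ((n : ℝ) + 1) ^ ε := by
    have a := harmonic_le_one_add_log n
    have b : Real.log n ≤ Real.log ((n : ℝ) + 1) := by
      rcases Nat.eq_zero_or_pos n with rfl | h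
      · simp
      · exact Real.log_le_log (by exact_mod_cast h) (by linarith)
    have c := Real.log_le_rpow_div hn.le hε0
    have d := Real.one_le_rpow hn1 hε0.le
    have e : (1 + 1 / ε) * ((n : ℝ) + 1) ^ ε = ((n : ℝ) + 1) ^ ε + ((n : ℝ) + 1) ^ ε / ε := by ring
    linarith
  rw [h2, Real.rpow_sub hn, div_le_iff₀ (by positivity)]
  have : (1 + 1 / ε) * (1 / (((n : ℝ) + 1) ^ σ / ((n : ℝ) + 1) ^ ε)) * ((n : ℝ) + 1) ^ σ = (1 + 1 / ε) * ((n : ℝ) + 1) ^ ε := by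
    have := Real.rpow_pos_of_pos hn σ
    have := Real.rpow_pos_of_pos hn ε
    field_simp
  rw [this]
  exact h3

lemma hasSum_harm {s : ℂ} (hs : 1 < s.re) :
    HasSum (fun n : ℕ => Complex.Gamma s * ((harmonic n : ℚ) : ℂ) / ((n : ℂ) + 1) ^ s)
      (- deriv (fun s => Complex.Gamma s * riemannZeta s) s
      + s * Complex.Gamma s * riemannZeta (s + 1) / 2 - mellin ff s) := by
  have h := hasSum_mellin (a := fun n : ℕ => ((harmonic n : ℚ) : ℂ)) (p := fun n : ℕ => (n : ℝ) + 1)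
    (F := fun t => (Lf t : ℂ) * phi t) (s := s)
    (fun i => Or.inr (by positivity)) (by linarith) (fun t ht => hasSum_L ht) (summable_harm hs)
  rw [mellin_L hs] at h
  push_cast at h
  exact h

end EulerAux

namespace EulerAux
open Filter Topology Asymptotics Set MeasureTheory

/-- `Γ ζ` in the left half plane -/
noncomputable def V (s : ℂ) : ℂ :=
  riemannZeta (1 - s) * (2 * (Real.pi : ℂ)) ^ s / (2 * Complex.cos (Real.pi * s / 2))

lemma cos_ne {s : ℂ} (h : ∀ k : ℤ, s ≠ 2 * k + 1) : Complex.cos (Real.pi * s / 2) ≠ 0 := by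
  rw [Complex.cos_ne_zero_iff]
  intro k hk
  apply h k
  have : (Real.pi : ℂ) ≠ 0 := by exact_mod_cast Real.pi_ne_zero
  field_simp at hk
  linear_combination hk

lemma V_an {s : ℂ} (hs0 : s ≠ 0) (h : ∀ k : ℤ, s ≠ 2 * k + 1) : AnalyticAt ℂ V s := by
  unfold V
  have hpi : (2 * (Real.pi : ℂ)) ≠ 0 := by simp [Real.pi_ne_zero]
  have h1 : AnalyticAt ℂ (fun s => riemannZeta (1 - s)) s :=
    AnalyticAt.fun_comp (g := riemannZeta) (f := fun s => 1 - s) (zeta_an (by simpa using hs0)) (by fun_prop)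
  have h2 : AnalyticAt ℂ (fun s => (2 * (Real.pi : ℂ)) ^ s) s := by
    have : Differentiable ℂ (fun s : ℂ => (2 * (Real.pi : ℂ)) ^ s) :=
      fun z => (differentiableAt_id.const_cpow (Or.inl hpi))
    exact this.analyticAt s
  refine (h1.fun_mul h2).fun_div ?_ (mul_ne_zero two_ne_zero (cos_ne h))
  have : Differentiable ℂ (fun s : ℂ => 2 * Complex.cos (Real.pi * s / 2)) := by fun_prop
  exact this.analyticAt s

lemma V_eq {s : ℂ} (hs : s.im ≠ 0) : V s = Complex.Gamma s * riemannZeta s := by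
  have h1 : ∀ n : ℕ, s ≠ -n := by rintro n rfl; simp at hs
  have h2 : s ≠ 1 := by rintro rfl; simp at hs
  have h3 : ∀ k : ℤ, s ≠ 2 * k + 1 := by rintro n rfl; simp at hs
  have h4 := cos_ne h3
  have hpi : (2 * (Real.pi : ℂ)) ≠ 0 := by simp [Real.pi_ne_zero]
  have h5 : (2 * (Real.pi : ℂ)) ^ s ≠ 0 := by simp [Complex.cpow_eq_zero_iff, Real.pi_ne_zero]
  rw [V, riemannZeta_one_sub h1 h2, Complex.cpow_neg]
  field_simp

open Classical in
/-- the middle term -/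
noncomputable def Mid (s : ℂ) : ℂ :=
  if 0 < s.re then - deriv (fun s => Complex.Gamma s * riemannZeta s) s * (Complex.Gamma s)⁻¹
  else - deriv V s * (Complex.Gamma s)⁻¹

lemma invGamma_an (s : ℂ) : AnalyticAt ℂ (fun s => (Complex.Gamma s)⁻¹) s :=
  differentiable_one_div_Gamma.analyticAt s

lemma Mid_an {s : ℂ} (hs : s ∈ eulerSumDomain) : AnalyticAt ℂ Mid s := by
  obtain ⟨h1, h0, hm⟩ := hs
  rcases lt_or_ge 0 s.re with hre | hre
  · have hG : AnalyticAt ℂ Complex.Gamma s := by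
      have : DifferentiableOn ℂ Complex.Gamma {z | 0 < z.re} := fun z hz =>
        (Complex.differentiableAt_Gamma z (fun m hm => by
          rw [hm] at hz
          simp at hz
          have : (0 : ℝ) ≤ m := by positivity
          linarith)).differentiableWithinAt
      exact this.analyticAt ((isOpen_lt continuous_const continuous_re).mem_nhds hre)
    have h := ((hG.fun_mul (zeta_an h1)).deriv.fun_neg).fun_mul (invGamma_an s)
    refine h.congr ?_
    have : ∀ᶠ z : ℂ in 𝓝 s, 0 < z.re := (isOpen_lt continuous_const continuous_re).mem_nhds hre
    filter_upwards [this] with z hz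
    simp [Mid, hz]
  · have hV : AnalyticAt ℂ V s := by
      refine V_an h0 fun k hk => ?_
      have hk0 : 2 * (k : ℝ) + 1 ≤ 0 := by
        rw [hk] at hre; simpa using hre
      have hk1 : k ≤ -1 := by
        have : 2 * k + 1 ≤ 0 := by exact_mod_cast hk0
        omega
      refine hm (-k).toNat (by omega) ?_
      have : (((-k).toNat : ℕ) : ℤ) = -k := Int.toNat_of_nonneg (by omega)
      have h' : (((-k).toNat : ℕ) : ℂ) = -(k : ℂ) := by exact_mod_cast congrArg (Int.cast : ℤ → ℂ) this
      rw [h', hk]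
      ring
    have h := (hV.deriv.fun_neg).fun_mul (invGamma_an s)
    refine h.congr ?_
    rcases hre.lt_or_eq with hlt | heq
    · have : ∀ᶠ z : ℂ in 𝓝 s, z.re < 0 := (isOpen_lt continuous_re continuous_const).mem_nhds hlt
      filter_upwards [this] with z hz
      simp [Mid, hz.not_gt]
    · have him : s.im ≠ 0 := fun h => h0 (Complex.ext heq h)
      have hU : IsOpen {z : ℂ | z.im ≠ 0} := isOpen_ne_fun continuous_im continuous_const
      filter_upwards [hU.mem_nhds him] with z hz
      have : V =ᶠ[𝓝 z] fun s => Complex.Gamma s * riemannZeta s := by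
        filter_upwards [hU.mem_nhds hz] with w hw using V_eq hw
      simp [Mid, this.deriv_eq]

lemma Mid_neg {m : ℕ} : Mid (-(2 * (m : ℂ))) = 0 := by
  have h := Complex.Gamma_neg_nat_eq_zero (2 * m)
  push_cast at h
  simp [Mid, h]

lemma convA_eq {m : ℕ} (hm : 1 ≤ m) : (Nat.factorial (2 * m) : ℂ) * convA (2 * m + 1)
    = ((bernoulli' (2 * m) : ℚ) : ℂ) * (1 / 2 + 1 / (4 * m)) := by
  unfold convA
  have hsub : ({1, 2 * m} : Finset ℕ) ⊆ Finset.Icc 1 (2 * m + 1) := by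
    intro k hk
    simp at hk ⊢
    omega
  rw [← Finset.sum_subset hsub, Finset.sum_pair (by omega)]
  · have e1 : 2 * m + 1 - 1 = 2 * m := by omega
    have e2 : 2 * m + 1 - 2 * m = 1 := by omega
    rw [e1, e2, bernoulli'_one]
    have h1 : ((2 * m).factorial : ℂ) ≠ 0 := by exact_mod_cast Nat.factorial_ne_zero _
    have h2 : (m : ℂ) ≠ 0 := by exact_mod_cast (by omega : m ≠ 0)
    push_cast
    simp only [Nat.factorial_one, Nat.cast_one]
    field_simp
    ring
  · intro k hk hk'
    simp at hk hk'
    rcases Nat.even_or_odd k with he | ho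
    · rw [bernoulli'_eq_zero_of_odd (n := 2 * m + 1 - k)]
      · simp
      · obtain ⟨r, rfl⟩ := he
        exact ⟨m - r, by omega⟩
      · obtain ⟨r, rfl⟩ := he
        omega
    · rw [bernoulli'_eq_zero_of_odd ho (by omega)]
      simp

end EulerAux

open EulerAux

/-- There is an analytic continuation `H` of the Euler sum `h(s) = Σ_{n=1}^∞ H_n n^{−s}`
to `U = ℂ \ ({1, 0} ∪ {1 − 2m : m ≥ 1})`, with
`H(−2m) − ζ(1 − 2m) = (2m)!·A_{2m+1}` for every integer `m ≥ 1`. -/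
theorem eulerSum_sub_zeta_eq_convA :
    ∃ H : ℂ → ℂ, AnalyticOnNhd ℂ H eulerSumDomain ∧
      (∀ s : ℂ, 1 < s.re →
        H s = ∑' n : ℕ, ((harmonic (n + 1) : ℚ) : ℂ) * ((n + 1 : ℕ) : ℂ) ^ (-s)) ∧
      (∀ m : ℕ, 1 ≤ m →
        H (-(2 * (m : ℂ))) - riemannZeta (1 - 2 * m)
          = (Nat.factorial (2 * m) : ℂ) * convA (2 * m + 1)) := by
  obtain ⟨R, hR1, hR2, hR3⟩ := exists_Rf
  refine ⟨fun s => riemannZeta (s + 1) * (1 + s / 2) + Mid s - R s, ?_, ?_, ?_⟩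
  · intro s hs
    have h1 : AnalyticAt ℂ (fun s : ℂ => 1 + s / 2) s := by fun_prop
    exact (((zeta_add_an hs.2.1).fun_mul h1).fun_add (Mid_an hs)).fun_sub (hR1.analyticAt s)
  · intro s hs
    have hs0 : 0 < s.re := by linarith
    have hG := Complex.Gamma_ne_zero_of_re_pos hs0
    have hA := (hasSum_harm hs).mul_left (Complex.Gamma s)⁻¹
    have hz : HasSum (fun n : ℕ => 1 / ((n : ℂ) + 1) ^ (s + 1)) (riemannZeta (s + 1)) := by
      have h1 : 1 < (s + 1).re := by simpa using hs0
      rw [zeta_eq_tsum_one_div_nat_add_one_cpow h1]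
      refine Summable.hasSum ?_
      have := (summable_nat_add_iff 1).2 (Complex.summable_one_div_nat_cpow.2 h1)
      simpa using this
    have hS := hA.add hz
    have hval : (Complex.Gamma s)⁻¹ * (- deriv (fun s => Complex.Gamma s * riemannZeta s) s
      + s * Complex.Gamma s * riemannZeta (s + 1) / 2 - mellin ff s) + riemannZeta (s + 1)
      = riemannZeta (s + 1) * (1 + s / 2) + Mid s - R s := by
      rw [hR2 s hs0, Mid, if_pos hs0]
      field_simp
      ring
    rw [hval] at hS
    show riemannZeta (s + 1) * (1 + s / 2) + Mid s - R s = _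
    rw [← hS.tsum_eq]
    refine tsum_congr fun n => ?_
    have hn : ((n : ℂ) + 1) ≠ 0 := by exact_mod_cast Nat.succ_ne_zero n
    have hn' : ((n : ℂ) + 1) ^ s ≠ 0 := by simp [Complex.cpow_eq_zero_iff, hn]
    rw [harmonic_succ, Complex.cpow_add _ _ hn, Complex.cpow_one]
    push_cast
    rw [Complex.cpow_neg]
    field_simp
  · intro m hm
    rw [convA_eq hm]
    have h1 := riemannZeta_neg_nat_eq_bernoulli' (2 * m - 1)
    have e1 : 2 * m - 1 + 1 = 2 * m := by omega
    have e2 : ((2 * m - 1 : ℕ) : ℂ) = 2 * m - 1 := by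
      rw [Nat.cast_sub (by omega)]; push_cast; ring
    rw [e1, e2] at h1
    have e3 : -(2 * (m : ℂ) - 1) = 1 - 2 * m := by ring
    have e4 : -(2 * (m : ℂ)) + 1 = 1 - 2 * m := by ring
    rw [e3] at h1
    show riemannZeta (-(2 * (m : ℂ)) + 1) * (1 + -(2 * (m : ℂ)) / 2) + Mid (-(2 * (m : ℂ)))
      - R (-(2 * (m : ℂ))) - riemannZeta (1 - 2 * m) = _
    rw [hR3 m hm, Mid_neg, e4, h1]
    have h2 : (m : ℂ) ≠ 0 := by exact_mod_cast (by omega : m ≠ 0)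
    field_simp
    ring
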